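/- Let f be a Hermitian positive definite 3×3 complex matrix with entries f_{ij} (indices 0, 1, 2) and let g = f⁻¹ with entries g_{ij}. Then the Schur complements d_X := f_{00} − f_{02}·f_{20}/f_{22} and d_Y := f_{11} − f_{12}·f_{21}/f_{22} are positive real numbers, the diagonal entries g_{00} and g_{11} are positive real numbers, and (f_{01} − f_{02}·f_{21}/f_{22}) / sqrt(d_X·d_Y) = −g_{01} / sqrt(g_{00}·g_{11}). (This is the paper's fast-computation identity for the partial coherence: R_{XY·Z} = s_{XY·Z}/sqrt(s_{XX·Z}·s_{YY·Z}) = −g_{XY}/sqrt(g_{XX}·g_{YY}).) -/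

import Mathlib

open Matrix
open scoped ComplexOrder

/-- The entries of the inverse of a `3 × 3` matrix over its first two indices are, up to the factor
`f₂₂ / det f` and a sign, the entries of the Schur complement of `f₂₂`. -/
theorem inv_fin_three_eq_schur {K : Type*} [Field K] (f : Matrix (Fin 3) (Fin 3) K)
    (h22 : f 2 2 ≠ 0) :
    f⁻¹ 0 0 = f 2 2 / f.det * (f 1 1 - f 1 2 * f 2 1 / f 2 2) ∧
    f⁻¹ 1 1 = f 2 2 / f.det * (f 0 0 - f 0 2 * f 2 0 / f 2 2) ∧
    f⁻¹ 0 1 = -(f 2 2 / f.det * (f 0 1 - f 0 2 * f 2 1 / f 2 2)) := by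
  rw [Matrix.inv_def, Matrix.adjugate_fin_three]
  simp only [Ring.inverse_eq_inv', Matrix.smul_apply, smul_eq_mul, Matrix.of_apply,
    Matrix.cons_val', Matrix.cons_val_zero, Matrix.cons_val_one]
  refine ⟨by field_simp, by field_simp, ?_⟩
  field_simp
  ring

/-- Fast-computation identity for the partial coherence:
`R_{XY·Z} = (f₀₁ − f₀₂·f₂₁/f₂₂)/sqrt(d_X·d_Y) = −g₀₁/sqrt(g₀₀·g₁₁)` where
`d_X = f₀₀ − f₀₂·f₂₀/f₂₂` and `d_Y = f₁₁ − f₁₂·f₂₁/f₂₂` are positive reals and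
`g = f⁻¹` has positive real diagonal entries `g₀₀, g₁₁`. -/
theorem stmt_6 (f : Matrix (Fin 3) (Fin 3) ℂ) (hf : f.PosDef)
    (g : Matrix (Fin 3) (Fin 3) ℂ) (hg : g = f⁻¹) :
    (0 < (f 0 0 - f 0 2 * f 2 0 / f 2 2).re ∧
      (f 0 0 - f 0 2 * f 2 0 / f 2 2).im = 0) ∧
    (0 < (f 1 1 - f 1 2 * f 2 1 / f 2 2).re ∧
      (f 1 1 - f 1 2 * f 2 1 / f 2 2).im = 0) ∧
    (0 < (g 0 0).re ∧ (g 0 0).im = 0) ∧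
    (0 < (g 1 1).re ∧ (g 1 1).im = 0) ∧
    (f 0 1 - f 0 2 * f 2 1 / f 2 2) /
        (Real.sqrt ((f 0 0 - f 0 2 * f 2 0 / f 2 2).re *
          (f 1 1 - f 1 2 * f 2 1 / f 2 2).re) : ℂ) =
      -g 0 1 / (Real.sqrt ((g 0 0).re * (g 1 1).re) : ℂ) := by
  subst hg
  have h22 : 0 < f 2 2 := hf.diag_pos
  obtain ⟨h00, h11, h01⟩ := inv_fin_three_eq_schur f h22.ne'
  have hg0 : 0 < f⁻¹ 0 0 := hf.inv.diag_pos
  have hg1 : 0 < f⁻¹ 1 1 := hf.inv.diag_pos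
  have hq : 0 < f 2 2 / f.det := div_pos h22 hf.det_pos
  generalize f 0 0 - f 0 2 * f 2 0 / f 2 2 = dX at *
  generalize f 1 1 - f 1 2 * f 2 1 / f 2 2 = dY at *
  generalize f 0 1 - f 0 2 * f 2 1 / f 2 2 = s at *
  generalize f 2 2 / f.det = q at *
  have hX : 0 < dX := pos_of_mul_pos_right (h11 ▸ hg1) hq.le
  have hY : 0 < dY := pos_of_mul_pos_right (h00 ▸ hg0) hq.le
  refine ⟨⟨(Complex.pos_iff.mp hX).1, (Complex.pos_iff.mp hX).2.symm⟩,
    ⟨(Complex.pos_iff.mp hY).1, (Complex.pos_iff.mp hY).2.symm⟩,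
    ⟨(Complex.pos_iff.mp hg0).1, (Complex.pos_iff.mp hg0).2.symm⟩,
    ⟨(Complex.pos_iff.mp hg1).1, (Complex.pos_iff.mp hg1).2.symm⟩, ?_⟩
  obtain ⟨hq_re, hq_im⟩ := Complex.pos_iff.mp hq
  have hsqrt : √((f⁻¹ 0 0).re * (f⁻¹ 1 1).re) = q.re * √(dX.re * dY.re) := by
    rw [h00, h11, Complex.mul_re, Complex.mul_re, ← hq_im,
      show (q.re * dY.re - 0 * dY.im) * (q.re * dX.re - 0 * dX.im) =
        q.re ^ 2 * (dX.re * dY.re) by ring,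
      Real.sqrt_mul (sq_nonneg _), Real.sqrt_sq hq_re.le]
  have hq_ofReal : (q.re : ℂ) = q := Complex.ext rfl hq_im
  rw [hsqrt, h01, Complex.ofReal_mul, hq_ofReal, neg_neg, mul_div_mul_left _ _ hq.ne']
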